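/- Let M₀ and M₁ be monoids. The direct product M₀ × M₁ is context-free (i.e. every language in VA(M₀ × M₁) is context-free) if and only if there is an i ∈ {0,1} such that M_i is context-free and M_{1−i} is an FRI-monoid. -/

import Mathlib

namespace Paper

/-- `VA M L`: the language `L ⊆ X*` is accepted by a valence automaton over the monoid `M`,
via the standard characterization: there are a finite alphabet `Y`, a regular language
`R ⊆ Y*`, and monoid homomorphisms `φ : Y* → M`, `h : Y* → X*` with `L = h(R ∩ φ⁻¹(1))`. -/
def VA (M : Type*) [Monoid M] {X : Type} (L : Language X) : Prop :=
  ∃ (Y : Type) (_ : Fintype Y) (R : Language Y)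
    (φ : FreeMonoid Y →* M) (h : FreeMonoid Y →* FreeMonoid X),
    R.IsRegular ∧
      L = (fun w => FreeMonoid.toList (h w)) ''
            {w : FreeMonoid Y | FreeMonoid.toList w ∈ R ∧ φ w = 1}

/-- `M` is an FRI-monoid: every finitely generated submonoid `N` of `M` has only
finitely many right-invertible elements. -/
def IsFRI (M : Type*) [Monoid M] : Prop :=
  ∀ N : Submonoid M, N.FG → {a : N | ∃ b : N, a * b = 1}.Finite

/-- The monoid `M` is context-free: every language in `VA M` (over every finite alphabet)
is context-free. -/
def MonoidContextFree (M : Type*) [Monoid M] : Prop :=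
  ∀ (X : Type) (_ : Fintype X) (L : Language X), VA M L → L.IsContextFree

/-! ### Derivation trees of context-free grammars -/

section Yields

variable {T : Type*} {g : ContextFreeGrammar T}

/-- `Yields g α w`: there is a forest of derivation trees of `g` whose roots are labelled by the
sentential form `α` and whose leaves spell the word `w`. -/
inductive Yields (g : ContextFreeGrammar T) : List (Symbol T g.NT) → List T → Prop
  | nil : Yields g [] []
  | terminal (a : T) {β : List (Symbol T g.NT)} {w : List T} (h : Yields g β w) :
      Yields g (.terminal a :: β) (a :: w)
  | nonterminal {r : ContextFreeRule T g.NT} (hr : r ∈ g.rules) {β : List (Symbol T g.NT)}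
      {w₁ w₂ : List T} (h₁ : Yields g r.output w₁) (h₂ : Yields g β w₂) :
      Yields g (.nonterminal r.input :: β) (w₁ ++ w₂)

theorem Yields.derives {α : List (Symbol T g.NT)} {w : List T} (h : Yields g α w) :
    g.Derives α (w.map .terminal) := by
  induction h with
  | nil => exact .refl _
  | terminal a _ ih => simpa using ih.append_left [Symbol.terminal a]
  | @nonterminal r hr β w₁ w₂ _ _ ih₁ ih₂ =>
    rw [List.map_append]
    refine ContextFreeGrammar.Produces.trans_derives ⟨r, hr, .head β⟩ ?_
    exact (ih₁.append_right β).trans (ih₂.append_left _)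

theorem Yields.exists_of_append {α β : List (Symbol T g.NT)} {w : List T}
    (h : Yields g (α ++ β) w) : ∃ w₁ w₂, w = w₁ ++ w₂ ∧ Yields g α w₁ ∧ Yields g β w₂ := by
  induction α generalizing w with
  | nil => exact ⟨[], w, rfl, .nil, h⟩
  | cons x α ih =>
    cases h with
    | terminal a h =>
      obtain ⟨w₁, w₂, rfl, h₁, h₂⟩ := ih h
      exact ⟨a :: w₁, w₂, rfl, .terminal a h₁, h₂⟩
    | nonterminal hr h₁ h₂ =>
      obtain ⟨w₁, w₂, rfl, h₃, h₄⟩ := ih h₂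
      exact ⟨_, w₂, (List.append_assoc _ _ _).symm, .nonterminal hr h₁ h₃, h₄⟩

theorem Yields.of_rewrites {r : ContextFreeRule T g.NT} (hr : r ∈ g.rules)
    {α β : List (Symbol T g.NT)} (hαβ : r.Rewrites α β) {w : List T} (h : Yields g β w) :
    Yields g α w := by
  induction hαβ generalizing w with
  | head s =>
    obtain ⟨w₁, w₂, rfl, h₁, h₂⟩ := h.exists_of_append
    exact .nonterminal hr h₁ h₂
  | cons x _ ih =>
    cases h with
    | terminal a h => exact .terminal a (ih h)
    | nonterminal hr' h₁ h₂ => exact .nonterminal hr' h₁ (ih h₂)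

theorem Yields.map_terminal (w : List T) : Yields g (w.map .terminal) w := by
  induction w with
  | nil => exact .nil
  | cons a w ih => exact .terminal a ih

theorem yields_iff_derives {α : List (Symbol T g.NT)} {w : List T} :
    Yields g α w ↔ g.Derives α (w.map .terminal) := by
  refine ⟨Yields.derives, fun h ↦ ?_⟩
  induction h using Relation.ReflTransGen.head_induction_on with
  | refl => exact .map_terminal w
  | head h _ ih =>
    obtain ⟨r, hr, hrw⟩ := h
    exact .of_rewrites hr hrw ih

theorem mem_language_iff_yields {w : List T} :
    w ∈ g.language ↔ Yields g [.nonterminal g.initial] w :=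
  yields_iff_derives.symm

/-- The suffixes of right-hand sides of rules, together with those of the initial sentential
form. -/
def itemSet (g : ContextFreeGrammar T) : Set (List (Symbol T g.NT)) :=
  {β | β <:+ [.nonterminal g.initial] ∨ ∃ r ∈ g.rules, β <:+ r.output}

theorem finite_itemSet (g : ContextFreeGrammar T) : (itemSet g).Finite := by
  have hsuff (l : List (Symbol T g.NT)) : {β | β <:+ l}.Finite := by
    simpa only [List.mem_tails] using l.tails.finite_toSet
  have : itemSet g = {β | β <:+ [.nonterminal g.initial]} ∪
      ⋃ r ∈ g.rules, {β | β <:+ r.output} := by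
    ext β
    simp [itemSet]
  rw [this]
  exact (hsuff _).union (g.rules.finite_toSet.biUnion fun r _ ↦ hsuff _)

theorem mem_itemSet_of_suffix {α β : List (Symbol T g.NT)} (h : β <:+ α) (hα : α ∈ itemSet g) :
    β ∈ itemSet g := by
  rcases hα with hα | ⟨r, hr, hα⟩
  exacts [.inl (h.trans hα), .inr ⟨r, hr, h.trans hα⟩]

/-- `IsContext g α β p q`: the sentential form `α` has partial derivation trees leading
to `p β q`. -/
def IsContext (g : ContextFreeGrammar T) (α β : List (Symbol T g.NT)) (p q : List T) : Prop :=
  ∀ m, Yields g β m → Yields g α (p ++ m ++ q)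

/-- Every derivation tree of a word `u v u' v'` has a node (after binarisation) that covers
either `v` and nothing of `v'`, or `u'` and nothing of `u`. -/
theorem Yields.exists_item {α : List (Symbol T g.NT)} {w : List T} (h : Yields g α w)
    (hα : α ∈ itemSet g) {u v u' v' : List T} (hw : w = u ++ (v ++ (u' ++ v'))) :
    ∃ β ∈ itemSet g, ∃ p m q, IsContext g α β p q ∧ Yields g β m ∧
      ((∃ s t t', u = p ++ s ∧ m = s ++ v ++ t ∧ u' = t ++ t' ∧ q = t' ++ v') ∨
        ∃ s s' t, p = u ++ s ∧ v = s ++ s' ∧ m = s' ++ u' ++ t ∧ v' = t ++ q) := by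
  induction h generalizing u v u' v' with
  | nil =>
    obtain ⟨rfl, rfl, rfl, rfl⟩ : u = [] ∧ v = [] ∧ u' = [] ∧ v' = [] := by simpa using hw
    exact ⟨[], hα, [], [], [], fun m hm ↦ by simpa using hm, .nil,
      .inl ⟨[], [], [], by simp⟩⟩
  | @terminal a β w hβ ih =>
    have hβα : β ∈ itemSet g := mem_itemSet_of_suffix (List.suffix_cons _ _) hα
    have hctx : IsContext g (.terminal a :: β) β [a] [] := fun m hm ↦ by
      simpa using Yields.terminal a hm
    rcases u with _ | ⟨b, u⟩
    · rcases v with _ | ⟨b, v⟩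
      · refine ⟨[], mem_itemSet_of_suffix List.nil_suffix hα, [], [], a :: w, fun m hm ↦ ?_, .nil,
          .inl ⟨[], [], u', by simpa using hw⟩⟩
        cases hm
        exact .terminal a hβ
      · obtain ⟨rfl, rfl⟩ : a = b ∧ w = v ++ (u' ++ v') := by simpa using hw
        exact ⟨β, hβα, [a], _, [], hctx, hβ, .inr ⟨[a], v, v', by simp⟩⟩
    · obtain ⟨rfl, rfl⟩ : a = b ∧ w = u ++ (v ++ (u' ++ v')) := by simpa using hw
      obtain ⟨γ, hγ, p, m, q, hc, hm, hcase⟩ := ih hβα rfl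
      refine ⟨γ, hγ, a :: p, m, q, fun m hm ↦ .terminal a (hc m hm), hm, ?_⟩
      rcases hcase with ⟨s, t, t', rfl, rfl, rfl, rfl⟩ | ⟨s, s', t, rfl, rfl, rfl, rfl⟩
      · exact .inl ⟨s, t, t', by simp⟩
      · exact .inr ⟨s, s', t, by simp⟩
  | @nonterminal r hr β w₁ w₂ h₁ h₂ ih₁ ih₂ =>
    have hβα : β ∈ itemSet g := mem_itemSet_of_suffix (List.suffix_cons _ _) hα
    have hrα : r.output ∈ itemSet g := .inr ⟨r, hr, List.suffix_rfl⟩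
    have hleft : IsContext g (.nonterminal r.input :: β) r.output [] w₂ := fun m hm ↦
      .nonterminal hr hm h₂
    have hright : IsContext g (.nonterminal r.input :: β) β w₁ [] := fun m hm ↦ by
      simpa using Yields.nonterminal hr h₁ hm
    rcases List.append_eq_append_iff.1 hw with ⟨u₂, rfl, rfl⟩ | ⟨c, rfl, hc⟩
    · obtain ⟨γ, hγ, p, m, q, hc, hm, hcase⟩ := ih₂ hβα rfl
      refine ⟨γ, hγ, w₁ ++ p, m, q, fun m hm ↦ ?_, hm, ?_⟩
      · simpa using hright _ (hc m hm)
      rcases hcase with ⟨s, t, t', rfl, rfl, rfl, rfl⟩ | ⟨s, s', t, rfl, rfl, rfl, rfl⟩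
      · exact .inl ⟨s, t, t', by simp⟩
      · exact .inr ⟨s, s', t, by simp⟩
    rcases List.append_eq_append_iff.1 hc with ⟨a, rfl, ha⟩ | ⟨c', rfl, rfl⟩
    swap
    · exact ⟨β, hβα, u ++ c, _, [], hright, h₂, .inr ⟨c, c', v', by simp⟩⟩
    rcases List.append_eq_append_iff.1 ha with ⟨c', rfl, rfl⟩ | ⟨c', rfl, rfl⟩
    swap
    · exact ⟨r.output, hrα, [], _, _, hleft, h₁, .inl ⟨u, a, c', by simp⟩⟩
    · obtain ⟨γ, hγ, p, m, q, hc, hm, hcase⟩ := ih₁ hrα rfl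
      refine ⟨γ, hγ, p, m, q ++ w₂, fun m hm ↦ ?_, hm, ?_⟩
      · simpa using hleft _ (hc m hm)
      rcases hcase with ⟨s, t, t', rfl, rfl, rfl, rfl⟩ | ⟨s, s', t, rfl, rfl, rfl, rfl⟩
      · exact .inl ⟨s, t, t', by simp⟩
      · exact .inr ⟨s, s', t, by simp⟩

end Yields

/-! ### Crossing dependencies are not context-free -/

theorem map_ofList_eq_one {X C : Type*} [Monoid C] (φ : FreeMonoid X →* C) {w : List X}
    (h : ∀ a ∈ w, φ (.of a) = 1) : φ (.ofList w) = 1 := by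
  induction w with
  | nil => exact map_one φ
  | cons a w ih =>
    rw [FreeMonoid.ofList_cons, map_mul, h a (by simp), ih fun b hb ↦ h b (by simp [hb]), one_mul]

/-- A sequence of crossing pairs `u i ⋯ u' i`, `v i ⋯ v' i`, where the pairs can be told apart by
two homomorphisms, cannot be embedded in a context-free language. -/
theorem not_isContextFree_of_crossing {X : Type} {A B : Type*} [Monoid A] [Monoid B]
    (f : FreeMonoid X →* A) (k : FreeMonoid X →* B) (L : Language X)
    (hL : ∀ w ∈ L, f (.ofList w) = 1 ∧ k (.ofList w) = 1)
    (u v u' v' : ℕ → List X) (hmem : ∀ i, u i ++ (v i ++ (u' i ++ v' i)) ∈ L)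
    (hfv : ∀ i, ∀ a ∈ v i, f (.of a) = 1) (hfv' : ∀ i, ∀ a ∈ v' i, f (.of a) = 1)
    (hku : ∀ i, ∀ a ∈ u i, k (.of a) = 1) (hku' : ∀ i, ∀ a ∈ u' i, k (.of a) = 1)
    (hf : ∀ i j, f (.ofList (u i)) * f (.ofList (u' j)) = 1 → i = j)
    (hk : ∀ i j, k (.ofList (v i)) * k (.ofList (v' j)) = 1 → i = j) :
    ¬ L.IsContextFree := by
  rintro ⟨g, rfl⟩
  have hinit : [Symbol.nonterminal g.initial] ∈ itemSet g := .inl List.suffix_rfl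
  choose β hβ p m q hctx hm hcase using fun i ↦
    (mem_language_iff_yields.1 (hmem i)).exists_item hinit rfl
  let c : ℕ → itemSet g × Prop := fun i ↦
    (⟨β i, hβ i⟩, ∃ s t t', u i = p i ++ s ∧ m i = s ++ v i ++ t ∧ u' i = t ++ t' ∧
      q i = t' ++ v' i)
  have := (finite_itemSet g).to_subtype
  obtain ⟨i, j, hij, hc⟩ := Finite.exists_ne_map_eq_of_infinite c
  have hβij : β i = β j := congrArg (fun x ↦ x.1.1) hc
  have hsub := hL _ (mem_language_iff_yields.2 (hctx i (m j) (hβij ▸ hm j)))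
  have hiff := iff_of_eq (congrArg Prod.snd hc)
  simp only [FreeMonoid.ofList_append, map_mul] at hsub
  by_cases hi : (c i).2
  · obtain ⟨s₂, t₂, t₂', hu₂, hm₂, hu₂', -⟩ := hiff.1 hi
    obtain ⟨s, t, t', hu, -, hu', hq⟩ := hi
    refine hij (hk j i ?_).symm
    have e₁ : k (.ofList (p i)) = 1 := map_ofList_eq_one k fun a ha ↦ hku i a (by simp [hu, ha])
    have e₂ : k (.ofList s₂) = 1 := map_ofList_eq_one k fun a ha ↦ hku j a (by simp [hu₂, ha])
    have e₃ : k (.ofList t₂) = 1 := map_ofList_eq_one k fun a ha ↦ hku' j a (by simp [hu₂', ha])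
    have e₄ : k (.ofList t') = 1 := map_ofList_eq_one k fun a ha ↦ hku' i a (by simp [hu', ha])
    simpa [hm₂, hq, FreeMonoid.ofList_append, e₁, e₂, e₃, e₄] using hsub.2
  · obtain ⟨s, s', t, hp, hv, -, hv'⟩ := (hcase i).resolve_left hi
    obtain ⟨s₂, s₂', t₂, -, hv₂, hm₂, hv₂'⟩ := (hcase j).resolve_left (hiff.not.1 hi)
    refine hij (hf i j ?_)
    have e₁ : f (.ofList s) = 1 := map_ofList_eq_one f fun a ha ↦ hfv i a (by simp [hv, ha])
    have e₂ : f (.ofList s₂') = 1 := map_ofList_eq_one f fun a ha ↦ hfv j a (by simp [hv₂, ha])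
    have e₃ : f (.ofList t₂) = 1 := map_ofList_eq_one f fun a ha ↦ hfv' j a (by simp [hv₂', ha])
    have e₄ : f (.ofList (q i)) = 1 := map_ofList_eq_one f fun a ha ↦ hfv' i a (by simp [hv', ha])
    simpa [hm₂, hp, FreeMonoid.ofList_append, e₁, e₂, e₃, e₄] using hsub.1

/-! ### Monoids that are not FRI -/

/-- A monoid with infinitely many right-invertible elements has infinitely many of them whose right
inverses separate them from each other. -/
theorem exists_separated_of_infinite {N : Type*} [Monoid N]
    (h : {a : N | ∃ b : N, a * b = 1}.Infinite) :
    ∃ r l : ℕ → N, ∀ i j, r i * l j = 1 ↔ i = j := by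
  by_cases hinj : ∃ a b : N, a * b = 1 ∧ ∀ n, 0 < n → a ^ n ≠ 1
  · obtain ⟨a, b, hab, hpow⟩ := hinj
    have hn (n : ℕ) : a ^ n * b ^ n = 1 := pow_mul_pow_eq_one n hab
    refine ⟨fun i ↦ a ^ i, fun j ↦ b ^ j, fun i j ↦ ⟨fun hij ↦ ?_, ?_⟩⟩
    · beta_reduce at hij
      by_contra hne
      rcases lt_or_gt_of_ne hne with hlt | hlt
      · obtain ⟨d, rfl⟩ := Nat.exists_eq_add_of_lt hlt
        rw [add_assoc, pow_add, ← mul_assoc, hn, one_mul] at hij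
        apply hpow (d + 1) d.succ_pos
        simpa [hij] using hn (d + 1)
      · obtain ⟨d, rfl⟩ := Nat.exists_eq_add_of_lt hlt
        apply hpow (d + 1) d.succ_pos
        rwa [add_assoc, add_comm, pow_add, mul_assoc, hn, mul_one] at hij
    · rintro rfl
      exact hn i
  · push Not at hinj
    have e := h.natEmbedding
    choose l hl using fun i ↦ (e i).2
    refine ⟨fun i ↦ e i, l, fun i j ↦ ⟨fun hij ↦ ?_, ?_⟩⟩
    · obtain ⟨n, hn, hpow⟩ := hinj (e j) (l j) (hl j)
      have hleft : l j * e j = 1 := by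
        obtain ⟨k, rfl⟩ := Nat.exists_eq_add_one.2 hn
        have hcl : (e j : N) ^ k * e j = 1 := by rw [← pow_succ, hpow]
        rwa [← left_inv_eq_right_inv hcl (hl j)]
      refine e.injective (Subtype.ext ?_)
      calc (e i : N) = e i * (l j * e j) := by rw [hleft, mul_one]
        _ = e j := by rw [← mul_assoc, hij, one_mul]
    · rintro rfl
      exact hl i

/-- In a monoid that is not FRI, infinitely many right-invertible elements separated by right
inverses can be written over a common finite alphabet. -/
theorem exists_words_of_not_isFRI {M : Type*} [Monoid M] (h : ¬ IsFRI M) :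
    ∃ (n : ℕ) (φ : FreeMonoid (Fin n) →* M) (r l : ℕ → FreeMonoid (Fin n)),
      ∀ i j, φ (r i) * φ (l j) = 1 ↔ i = j := by
  simp only [IsFRI, not_forall] at h
  obtain ⟨N, ⟨S, hS⟩, hinf⟩ := h
  obtain ⟨r, l, hrl⟩ := exists_separated_of_infinite hinf
  let φ : FreeMonoid (Fin S.card) →* M := FreeMonoid.lift fun i ↦ (S.equivFin.symm i : M)
  have hsurj (a : N) : ∃ w, φ w = a := by
    have hrange : Set.range (fun i ↦ (S.equivFin.symm i : M)) = S := by
      rw [Set.range_comp' Subtype.val, S.equivFin.symm.range_eq_univ]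
      simp
    have ha : (a : M) ∈ MonoidHom.mrange φ := by
      rw [FreeMonoid.mrange_lift, hrange, hS]
      exact a.2
    exact ha
  choose r' hr' using fun i ↦ hsurj (r i)
  choose l' hl' using fun i ↦ hsurj (l i)
  refine ⟨_, φ, r', l', fun i j ↦ ?_⟩
  rw [← hrl, hr', hl', ← Submonoid.coe_mul, OneMemClass.coe_eq_one]

theorem not_monoidContextFree_prod {M₀ M₁ : Type*} [Monoid M₀] [Monoid M₁]
    (h₀ : ¬ IsFRI M₀) (h₁ : ¬ IsFRI M₁) : ¬ MonoidContextFree (M₀ × M₁) := by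
  obtain ⟨n₀, φ₀, r₀, l₀, hrl₀⟩ := exists_words_of_not_isFRI h₀
  obtain ⟨n₁, φ₁, r₁, l₁, hrl₁⟩ := exists_words_of_not_isFRI h₁
  let f : FreeMonoid (Fin n₀ ⊕ Fin n₁) →* M₀ :=
    FreeMonoid.lift (Sum.elim (fun a ↦ φ₀ (.of a)) fun _ ↦ 1)
  let k : FreeMonoid (Fin n₀ ⊕ Fin n₁) →* M₁ :=
    FreeMonoid.lift (Sum.elim (fun _ ↦ 1) fun a ↦ φ₁ (.of a))
  have hf (w : FreeMonoid (Fin n₀)) : f (.map Sum.inl w) = φ₀ w := by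
    rw [← MonoidHom.comp_apply]
    congr 1
    exact FreeMonoid.hom_eq fun a ↦ by simp [f]
  have hk (w : FreeMonoid (Fin n₁)) : k (.map Sum.inr w) = φ₁ w := by
    rw [← MonoidHom.comp_apply]
    congr 1
    exact FreeMonoid.hom_eq fun a ↦ by simp [k]
  have hf' (w : FreeMonoid (Fin n₁)) : f (.map Sum.inr w) = 1 := by
    rw [← MonoidHom.comp_apply, ← MonoidHom.one_apply w]
    congr 1
    exact FreeMonoid.hom_eq fun a ↦ by simp [f]
  have hk' (w : FreeMonoid (Fin n₀)) : k (.map Sum.inl w) = 1 := by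
    rw [← MonoidHom.comp_apply, ← MonoidHom.one_apply w]
    congr 1
    exact FreeMonoid.hom_eq fun a ↦ by simp [k]
  let L : Language (Fin n₀ ⊕ Fin n₁) := {w | f (.ofList w) = 1 ∧ k (.ofList w) = 1}
  intro hcf
  refine not_isContextFree_of_crossing f k L (fun w hw ↦ hw)
    (fun i ↦ (FreeMonoid.map Sum.inl (r₀ i)).toList)
    (fun i ↦ (FreeMonoid.map Sum.inr (r₁ i)).toList)
    (fun i ↦ (FreeMonoid.map Sum.inl (l₀ i)).toList)
    (fun i ↦ (FreeMonoid.map Sum.inr (l₁ i)).toList) (fun i ↦ ?_)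
    ?_ ?_ ?_ ?_ ?_ ?_ (hcf _ inferInstance L ?_)
  · constructor <;>
      simp [FreeMonoid.ofList_append, hf, hk, hf', hk', (hrl₀ i i).2 rfl, (hrl₁ i i).2 rfl,
        -FreeMonoid.toList_map]
  · simp [FreeMonoid.toList_map, f]
  · simp [FreeMonoid.toList_map, f]
  · simp [FreeMonoid.toList_map, k]
  · simp [FreeMonoid.toList_map, k]
  · simp [hf, hrl₀, -FreeMonoid.toList_map]
  · simp [hk, hrl₁, -FreeMonoid.toList_map]
  · refine ⟨_, inferInstance, ⊤, f.prod k, .id _, ?_, ?_⟩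
    · exact ⟨Unit, inferInstance, ⟨fun _ _ ↦ (), (), Set.univ⟩, rfl⟩
    · ext w
      constructor
      · intro hw
        exact ⟨.ofList w, ⟨trivial, Prod.ext hw.1 hw.2⟩, rfl⟩
      · rintro ⟨w, ⟨-, hw⟩, rfl⟩
        exact ⟨congrArg Prod.fst hw, congrArg Prod.snd hw⟩

/-! ### Products with FRI-monoids -/

theorem VA.of_injective {M N : Type*} [Monoid M] [Monoid N] (f : M →* N)
    (hf : Function.Injective f) {X : Type} {L : Language X} (h : VA M L) : VA N L := by
  obtain ⟨Y, hY, R, φ, k, hR, rfl⟩ := h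
  exact ⟨Y, hY, R, f.comp φ, k, hR, by
    simp only [MonoidHom.comp_apply, map_eq_one_iff f hf]
    rfl⟩

theorem MonoidContextFree.of_injective {M N : Type*} [Monoid M] [Monoid N] (f : M →* N)
    (hf : Function.Injective f) (h : MonoidContextFree N) : MonoidContextFree M :=
  fun X hX L hL ↦ h X hX L (hL.of_injective f hf)

/-- The identity language of a finitely generated submonoid of an FRI-monoid is regular. -/
theorem IsFRI.isRegular {M : Type*} [Monoid M] (h : IsFRI M) {Y : Type} [Finite Y]
    (φ : FreeMonoid Y →* M) :
    Language.IsRegular ({w | φ (.ofList w) = 1} : Set (List Y)) := by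
  set K : Language Y := ({w | φ (.ofList w) = 1} : Set (List Y))
  have hfg : (MonoidHom.mrange φ).FG := by
    rw [← FreeMonoid.lift_restrict φ, FreeMonoid.mrange_lift]
    exact Submonoid.fg_iff _ |>.2 ⟨_, rfl, Set.finite_range _⟩
  let F : MonoidHom.mrange φ → Language Y := fun a ↦
    ({y | a.1 * φ (.ofList y) = 1} : Set (List Y))
  refine .of_finite_range_leftQuotient
    ((((h _ hfg).image F).union (Set.finite_singleton 0)).subset ?_)
  rintro _ ⟨w, rfl⟩
  have hmem (y : List Y) : y ∈ K.leftQuotient w ↔ φ (.ofList w) * φ (.ofList y) = 1 := by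
    rw [← map_mul, ← FreeMonoid.ofList_append]
    rfl
  by_cases hne : ∃ y, y ∈ K.leftQuotient w
  · obtain ⟨y, hy⟩ := hne
    refine .inl ⟨⟨φ (.ofList w), _, rfl⟩, ⟨⟨φ (.ofList y), _, rfl⟩, ?_⟩, ?_⟩
    · exact Subtype.ext ((hmem y).1 hy)
    · ext y
      exact (hmem y).symm
  · push Not at hne
    exact .inr (Set.eq_empty_of_forall_notMem hne)

theorem MonoidContextFree.prod {M₀ M₁ : Type*} [Monoid M₀] [Monoid M₁]
    (h₀ : MonoidContextFree M₀) (h₁ : IsFRI M₁) : MonoidContextFree (M₀ × M₁) := by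
  rintro X hX _ ⟨Y, hY, R, φ, k, hR, rfl⟩
  refine h₀ X hX _ ⟨Y, hY, _, (MonoidHom.fst M₀ M₁).comp φ, k,
    hR.inf (h₁.isRegular ((MonoidHom.snd M₀ M₁).comp φ)), ?_⟩
  congr 1
  ext w
  simp only [Set.mem_ofPred_eq, Prod.ext_iff]
  exact ⟨fun ⟨hw, h, h'⟩ ↦ ⟨⟨hw, h'⟩, h⟩, fun ⟨⟨hw, h'⟩, h⟩ ↦ ⟨hw, h, h'⟩⟩

/-- The direct product `M₀ × M₁` is context-free iff for some
`i ∈ {0,1}`, `M_i` is context-free and `M_{1-i}` is an FRI-monoid. -/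
theorem stmt7 (M₀ M₁ : Type*) [Monoid M₀] [Monoid M₁] :
    MonoidContextFree (M₀ × M₁) ↔
      (MonoidContextFree M₀ ∧ IsFRI M₁) ∨ (MonoidContextFree M₁ ∧ IsFRI M₀) := by
  constructor
  · intro h
    have h₀ := h.of_injective (.inl M₀ M₁) (Prod.mk_left_injective 1)
    have h₁ := h.of_injective (.inr M₀ M₁) (Prod.mk_right_injective 1)
    by_cases hF₀ : IsFRI M₀
    · exact .inr ⟨h₁, hF₀⟩
    · exact .inl ⟨h₀, of_not_not fun hF₁ ↦ not_monoidContextFree_prod hF₀ hF₁ h⟩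
  · rintro (⟨h, hF⟩ | ⟨h, hF⟩)
    · exact h.prod hF
    · exact (h.prod hF).of_injective (MulEquiv.prodComm (M := M₀) (N := M₁)).toMonoidHom
        MulEquiv.prodComm.injective

end Paper
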